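/- Let X be a Hausdorff topological space. The relation ≥ᵣ on paths in X is transitive: if α, β, γ : [0,1] → X are paths with α ≥ᵣ β and β ≥ᵣ γ, then α ≥ᵣ γ. -/

import Mathlib

open Set Filter Topology

noncomputable section

/-- An ℝ-tree: a nonempty geodesic, uniquely arcwise connected, locally arcwise connected
metric space. -/
structure IsRTree (T : Type) [MetricSpace T] : Prop where
  nonempty : Nonempty T
  geodesic : ∀ x y : T, ∃ γ : ℝ → T, γ 0 = x ∧ γ (dist x y) = y ∧
    ∀ s ∈ Set.Icc (0:ℝ) (dist x y), ∀ t ∈ Set.Icc (0:ℝ) (dist x y),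
      dist (γ s) (γ t) = |s - t|
  uniquelyArcwise : ∀ p q : unitInterval → T, Continuous p → Continuous q →
    Function.Injective p → Function.Injective q → p 0 = q 0 → p 1 = q 1 →
    Set.range p = Set.range q
  locallyArcwise : LocPathConnectedSpace T

/-- `β` is a geodesic ℝ-tree reduction of `α`, i.e. `α ≥ᵣ β`. -/
def GeodesicReduction {X : Type*} [TopologicalSpace X] (α β : unitInterval → X) : Prop :=
  ∃ (T : Type) (_ : MetricSpace T), IsRTree T ∧
    ∃ (f : T → X) (p r : unitInterval → T),
      Continuous f ∧ Continuous p ∧ Continuous r ∧ Function.Injective r ∧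
      r 0 = p 0 ∧ r 1 = p 1 ∧ f ∘ p = α ∧ f ∘ r = β

/-- The concatenation of `α` with the reverse of `β`: `α` on `[0,1/2]`, reverse of `β`
on `[1/2,1]`. -/
def ConcatReverse {X : Type*} (α β : unitInterval → X) : unitInterval → X :=
  fun t => if (t : ℝ) ≤ 1 / 2
    then α (Set.projIcc (0:ℝ) 1 zero_le_one (2 * (t : ℝ)))
    else β (Set.projIcc (0:ℝ) 1 zero_le_one (2 - 2 * (t : ℝ)))

/-- The standard concatenation `α·β`: `α` on `[0,1/2]`, `β` on `[1/2,1]`. -/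
def PathConcat {X : Type*} (α β : unitInterval → X) : unitInterval → X :=
  fun t => if (t : ℝ) ≤ 1 / 2
    then α (Set.projIcc (0:ℝ) 1 zero_le_one (2 * (t : ℝ)))
    else β (Set.projIcc (0:ℝ) 1 zero_le_one (2 * (t : ℝ) - 1))

/-- `α ≃ᵣ β`: the loop `α·(reverse β)` factors through an ℝ-tree. -/
def RTreeHomotopic {X : Type*} [TopologicalSpace X] (α β : unitInterval → X) : Prop :=
  α 0 = β 0 ∧ α 1 = β 1 ∧
  ∃ (T : Type) (_ : MetricSpace T), IsRTree T ∧
    ∃ (f : T → X) (ℓ : unitInterval → T),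
      Continuous f ∧ Continuous ℓ ∧ ℓ 0 = ℓ 1 ∧ f ∘ ℓ = ConcatReverse α β

/-- `α ≡ β`: equality up to an increasing self-homeomorphism of `[0,1]`. -/
def PathEquiv {X : Type*} (α β : unitInterval → X) : Prop :=
  ∃ h : unitInterval ≃ₜ unitInterval, StrictMono (⇑h) ∧ α = β ∘ ⇑h

/-- Fréchet equivalence of paths. -/
def FrechetEquiv {X : Type*} (α β : unitInterval → X) : Prop :=
  ∃ f g : unitInterval → unitInterval,
    Continuous f ∧ Continuous g ∧ Monotone f ∧ Monotone g ∧
    Function.Surjective f ∧ Function.Surjective g ∧ α ∘ f = β ∘ g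

/-- `p` lifts all paths uniquely rel. starting point. -/
def LiftsPathsUniquely {E X : Type*} [TopologicalSpace E] [TopologicalSpace X]
    (p : E → X) : Prop :=
  ∀ α : unitInterval → X, Continuous α → ∀ e : E, p e = α 0 →
    ∃! αl : unitInterval → E, Continuous αl ∧ αl 0 = e ∧ p ∘ αl = α

/-- An open `U ⊆ (0,1)` is a Cantor complement if `[0,1] \ U` is homeomorphic to the
Cantor set. -/
def IsCantorComplement (U : Set ℝ) : Prop :=
  IsOpen U ∧ U ⊆ Set.Ioo 0 1 ∧ Nonempty (↥(Set.Icc (0:ℝ) 1 \ U) ≃ₜ (ℕ → Bool))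

/-- `𝒪(α)`: the set of points of `[0,1]` (as reals) at which `α` is locally constant. -/
def Oset {X : Type*} [TopologicalSpace X] (α : unitInterval → X) : Set ℝ :=
  {x | ∃ hx : x ∈ unitInterval,
    ∃ U ∈ nhds (⟨x, hx⟩ : unitInterval), ∀ s ∈ U, α s = α ⟨x, hx⟩}

/-- A Cantor path: a non-constant path whose locally-constant set is a Cantor complement. -/
def IsCantorPath {X : Type*} [TopologicalSpace X] (α : unitInterval → X) : Prop :=
  Continuous α ∧ (∃ s t, α s ≠ α t) ∧ IsCantorComplement (Oset α)

/-- Two Cantor paths are staggered if their locally-constant sets cover `(0,1)`. -/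
def StaggeredPaths {X : Type*} [TopologicalSpace X] (α β : unitInterval → X) : Prop :=
  Oset α ∪ Oset β = Set.Ioo 0 1

/-- The restriction of `β` to `[a,b]`, linearly reparameterized on `[0,1]`. -/
def restrictIcc {X : Type*} (β : unitInterval → X) (a b : ℝ) : unitInterval → X :=
  fun t => β (Set.projIcc (0:ℝ) 1 zero_le_one (a + (b - a) * (t : ℝ)))

/-- A Cantor-inverse-pair loop (CIP-loop). -/
def IsCIPLoop {X : Type*} [TopologicalSpace X] (ℓ : unitInterval → X) : Prop :=
  ∃ (α : unitInterval → X) (h : unitInterval ≃ₜ unitInterval), StrictMono (⇑h) ∧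
    ℓ ∘ ⇑h = ConcatReverse α α ∧
    (IsCantorPath α ∨
      ∃ (α₁ : unitInterval → X) (x : X) (h' : unitInterval ≃ₜ unitInterval),
        StrictMono (⇑h') ∧ IsCantorPath α₁ ∧ α ∘ ⇑h' = PathConcat α₁ (fun _ => x))

/-- `β` is a `𝒰`-extension of `α` for `𝒰` a set of connected components of `𝒪(α)`. -/
def UExtension {X : Type*} [TopologicalSpace X] (α β : unitInterval → X)
    (𝒰 : Set (Set ℝ)) : Prop :=
  (∀ J ∈ 𝒰, ∃ x ∈ Oset α, J = connectedComponentIn (Oset α) x) ∧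
  (∀ t : unitInterval, (t : ℝ) ∉ ⋃₀ 𝒰 → β t = α t) ∧
  (∀ J ∈ 𝒰, IsCIPLoop (restrictIcc β (sInf J) (sSup J)))

/-- `α ⪯* β`: `β` is a `𝒰`-extension of `α` for some `𝒰 ⊆ lc(α)`. -/
def PrecExt {X : Type*} [TopologicalSpace X] (α β : unitInterval → X) : Prop :=
  ∃ 𝒰 : Set (Set ℝ), UExtension α β 𝒰

/-- The sup-metric `ρ` on paths into a metric space. -/
def pathDist {X : Type*} [PseudoMetricSpace X] (α β : unitInterval → X) : ℝ :=
  ⨆ t : unitInterval, dist (α t) (β t)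

/-- The image of a set `U ⊆ [0,1] ⊆ ℝ` under a self-homeomorphism of `[0,1]`. -/
def imageOnIcc (f : unitInterval ≃ₜ unitInterval) (U : Set ℝ) : Set ℝ :=
  Subtype.val '' (⇑f '' (Subtype.val ⁻¹' U))

/-- The Euclidean half-space of dimension `n` (all of `ℝ⁰` when `n = 0`). -/
def halfSpace (n : ℕ) : Set (EuclideanSpace ℝ (Fin n)) :=
  {y | ∀ i : Fin n, (i : ℕ) = 0 → 0 ≤ y i}

/-- A topological manifold with (possibly empty) boundary: second countable, Hausdorff,
locally homeomorphic to open subsets of Euclidean half-spaces. -/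
def IsTopManifold (M : Type*) [TopologicalSpace M] : Prop :=
  SecondCountableTopology M ∧ T2Space M ∧
  ∀ x : M, ∃ (n : ℕ) (U : Set M) (V : Set (halfSpace n)),
    U ∈ nhds x ∧ IsOpen V ∧ Nonempty (↥U ≃ₜ ↥V)

/-- The closed unit disk in the Euclidean plane. -/
abbrev Disk2 : Type := ↥(Metric.closedBall (0 : EuclideanSpace ℝ (Fin 2)) 1)

end

section MetricTrees

/-- The four-point condition characterizing `0`-hyperbolic spaces. -/
def FourPoint (T : Type*) [PseudoMetricSpace T] : Prop :=
  ∀ x y z w : T, dist x y + dist z w ≤ max (dist x z + dist y w) (dist x w + dist y z)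

/-- Between any two points there are points at every intermediate distance. -/
def HasIntermediatePoints (T : Type*) [PseudoMetricSpace T] : Prop :=
  ∀ (x y : T) (v : ℝ), 0 ≤ v → v ≤ dist x y → ∃ z, dist x z = v ∧ dist z y = dist x y - v

/-- `γ` restricts to a unit-speed geodesic from `x` to `y`. -/
def IsUnitGeodesic {T : Type*} [MetricSpace T] (γ : ℝ → T) (x y : T) : Prop :=
  γ 0 = x ∧ γ (dist x y) = y ∧
    ∀ s ∈ Set.Icc (0:ℝ) (dist x y), ∀ t ∈ Set.Icc (0:ℝ) (dist x y), dist (γ s) (γ t) = |s - t|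

namespace IsUnitGeodesic

variable {T : Type*} [MetricSpace T] {γ : ℝ → T} {x y : T}

theorem continuousOn (h : IsUnitGeodesic γ x y) : ContinuousOn γ (Set.Icc 0 (dist x y)) := by
  refine (LipschitzOnWith.of_dist_le_mul (K := 1) fun s hs t ht => ?_).continuousOn
  simp [h.2.2 s hs t ht, Real.dist_eq]

theorem injOn (h : IsUnitGeodesic γ x y) : Set.InjOn γ (Set.Icc 0 (dist x y)) := by
  intro s hs t ht hst
  have := h.2.2 s hs t ht
  rw [hst, dist_self] at this
  exact sub_eq_zero.1 (abs_eq_zero.1 this.symm)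

theorem dist_left (h : IsUnitGeodesic γ x y) {t : ℝ} (ht : t ∈ Set.Icc 0 (dist x y)) :
    dist x (γ t) = t := by
  have := h.2.2 0 ⟨le_rfl, dist_nonneg⟩ t ht
  rwa [h.1, zero_sub, abs_neg, abs_of_nonneg ht.1] at this

theorem dist_right (h : IsUnitGeodesic γ x y) {t : ℝ} (ht : t ∈ Set.Icc 0 (dist x y)) :
    dist (γ t) y = dist x y - t := by
  have := h.2.2 t ht _ ⟨dist_nonneg, le_rfl⟩
  rwa [h.2.1, abs_sub_comm, abs_of_nonneg (sub_nonneg.2 ht.2)] at this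

end IsUnitGeodesic

section FourPoint

variable {T : Type*} [MetricSpace T]

theorem FourPoint.exists_median (h4 : FourPoint T) (hI : HasIntermediatePoints T) (a b w : T) :
    ∃ m, dist a m + dist m b = dist a b ∧ dist w m + dist m a = dist w a ∧
      dist w m + dist m b = dist w b := by
  have h1 := dist_triangle_left a b w
  have h2 := dist_triangle w b a
  have h2' := dist_triangle w a b
  rw [dist_comm b a] at h2
  obtain ⟨m, hm1, hm2⟩ := hI w a ((dist w a + dist w b - dist a b) / 2) (by linarith) (by linarith)
  have h3 := dist_triangle w m b
  have h5 := dist_triangle a m b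
  have h4' := h4 w a m b
  have e1 := dist_comm a m
  refine ⟨m, ?_⟩
  rcases le_max_iff.1 h4' with h | h <;> refine ⟨?_, ?_, ?_⟩ <;> linarith

theorem FourPoint.mem_of_isPreconnected (h4 : FourPoint T) {K : Set T} (hK : IsPreconnected K)
    {x y m : T} (hx : x ∈ K) (hy : y ∈ K) (hm : dist x m + dist m y = dist x y) : m ∈ K := by
  by_contra hmK
  have key : dist x y < dist x m + dist m y := by
    refine hK.induction₂ (fun x y => dist x y < dist x m + dist m y) ?_ ?_ ?_ hx hy
    · intro a ha
      have hpos : 0 < dist a m := dist_pos.2 (fun h => hmK (h ▸ ha))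
      filter_upwards [mem_nhdsWithin_of_mem_nhds (Metric.ball_mem_nhds a hpos)] with z hz
      have := Metric.mem_ball'.1 hz
      have := dist_nonneg (x := m) (y := z)
      linarith
    · intro a b c _ _ _ hab hbc
      have e1 := dist_comm m b
      have e2 := dist_comm m c
      have e3 := dist_comm b c
      rcases le_max_iff.1 (h4 a c b m) with h | h <;> linarith
    · intro a b _ _ h
      rw [dist_comm b a, dist_comm b m, dist_comm m a]
      linarith
  linarith

theorem FourPoint.eq_of_forall_le_dist (h4 : FourPoint T) (hI : HasIntermediatePoints T)
    {K : Set T} (hK : IsPreconnected K) {o x y : T} (hx : x ∈ K) (hy : y ∈ K)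
    (hxy : dist o x = dist o y) (hle : ∀ z ∈ K, dist o x ≤ dist o z) : x = y := by
  obtain ⟨m, h1, h2, h3⟩ := h4.exists_median hI x y o
  have hm := hle m (h4.mem_of_isPreconnected hK hx hy h1)
  have e := dist_comm x m
  have := dist_nonneg (x := x) (y := y)
  exact dist_le_zero.1 (by linarith)

theorem FourPoint.arc_mem_segment (h4 : FourPoint T) (hI : HasIntermediatePoints T)
    {p : unitInterval → T} (hp : Continuous p) (hpi : Function.Injective p) (t : unitInterval) :
    dist (p 0) (p t) + dist (p t) (p 1) = dist (p 0) (p 1) := by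
  obtain ⟨m, h1, h2, h3⟩ := h4.exists_median hI (p 0) (p 1) (p t)
  have m1 : m ∈ p '' Set.Icc 0 t := by
    refine h4.mem_of_isPreconnected (isPreconnected_Icc.image _ hp.continuousOn)
      ⟨t, ⟨t.2.1, le_rfl⟩, rfl⟩ ⟨0, ⟨le_rfl, t.2.1⟩, rfl⟩ h2
  have m2 : m ∈ p '' Set.Icc t 1 := by
    refine h4.mem_of_isPreconnected (isPreconnected_Icc.image _ hp.continuousOn)
      ⟨t, ⟨le_rfl, t.2.2⟩, rfl⟩ ⟨1, ⟨t.2.2, le_rfl⟩, rfl⟩ h3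
  obtain ⟨a, ha, rfl⟩ := m1
  obtain ⟨b, hb, hab⟩ := m2
  obtain rfl := hpi hab
  obtain rfl : b = t := le_antisymm ha.2 hb.1
  exact h1

theorem FourPoint.range_arc (h4 : FourPoint T) (hI : HasIntermediatePoints T)
    {p : unitInterval → T} (hp : Continuous p) (hpi : Function.Injective p) :
    Set.range p = {z | dist (p 0) z + dist z (p 1) = dist (p 0) (p 1)} := by
  ext z
  constructor
  · rintro ⟨t, rfl⟩
    exact h4.arc_mem_segment hI hp hpi t
  · intro hz
    exact h4.mem_of_isPreconnected (isPreconnected_range hp) ⟨0, rfl⟩ ⟨1, rfl⟩ hz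

theorem FourPoint.dist_of_mem_segment (h4 : FourPoint T) {a b x y : T}
    (hx : dist a x + dist x b = dist a b) (hy : dist a y + dist y b = dist a b) :
    dist x y = |dist a x - dist a y| := by
  refine le_antisymm ?_ (by simpa only [dist_comm a] using abs_dist_sub_le x y a)
  have e1 := dist_comm a x
  have e2 := dist_comm a y
  rcases le_max_iff.1 (h4 x y a b) with h | h
  · refine le_trans ?_ (le_abs_self _)
    linarith
  · refine le_trans ?_ (neg_le_abs _)
    linarith

theorem FourPoint.exists_geodesic (h4 : FourPoint T) (hI : HasIntermediatePoints T) (x y : T) :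
    ∃ γ : ℝ → T, IsUnitGeodesic γ x y := by
  have hex : ∀ v : ℝ, ∃ z, v ∈ Set.Icc (0:ℝ) (dist x y) →
      dist x z = v ∧ dist z y = dist x y - v := by
    intro v
    by_cases hv : v ∈ Set.Icc (0:ℝ) (dist x y)
    · obtain ⟨z, hz⟩ := hI x y v hv.1 hv.2
      exact ⟨z, fun _ => hz⟩
    · exact ⟨x, fun h => absurd h hv⟩
  choose γ hγ using hex
  refine ⟨γ, ?_, ?_, ?_⟩
  · exact (dist_eq_zero.1 (hγ 0 ⟨le_rfl, dist_nonneg⟩).1).symm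
  · exact dist_eq_zero.1 (by rw [(hγ _ ⟨dist_nonneg, le_rfl⟩).2, sub_self])
  · intro s hs t ht
    have h1 := hγ s hs
    have h2 := hγ t ht
    rw [h4.dist_of_mem_segment (a := x) (b := y) (by linarith) (by linarith), h1.1, h2.1]

end FourPoint

theorem FourPoint.isRTree {T : Type} [MetricSpace T] [Nonempty T] (h4 : FourPoint T)
    (hI : HasIntermediatePoints T) : IsRTree T where
  nonempty := ‹_›
  geodesic := h4.exists_geodesic hI
  uniquelyArcwise p q hp hq hpi hqi h0 h1 := by
    rw [h4.range_arc hI hp hpi, h4.range_arc hI hq hqi, h0, h1]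
  locallyArcwise := by
    refine LocallyPathConnectedSpace.of_bases (fun x => Metric.nhds_basis_ball) ?_
    intro x ε hε
    refine ⟨x, Metric.mem_ball_self hε, fun {y} hy => ?_⟩
    obtain ⟨γ, hγ⟩ := h4.exists_geodesic hI x y
    have hmem : ∀ t ∈ unitInterval, t * dist x y ∈ Set.Icc (0:ℝ) (dist x y) := fun t ht =>
      ⟨mul_nonneg ht.1 dist_nonneg, mul_le_of_le_one_left dist_nonneg ht.2⟩
    refine JoinedIn.ofLine (f := fun t => γ (t * dist x y))
      (hγ.continuousOn.comp (by fun_prop) hmem) (by simpa using hγ.1) (by simpa using hγ.2.1) ?_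
    rintro _ ⟨t, ht, rfl⟩
    rw [Metric.mem_ball', hγ.dist_left (hmem t ht)]
    exact (hmem t ht).2.trans_lt (Metric.mem_ball'.1 hy)

namespace IsRTree

variable {T : Type} [MetricSpace T]

theorem hasIntermediatePoints (hT : IsRTree T) : HasIntermediatePoints T := by
  intro x y v hv hv'
  obtain ⟨γ, hγ⟩ := hT.geodesic x y
  exact ⟨γ v, IsUnitGeodesic.dist_left hγ ⟨hv, hv'⟩, IsUnitGeodesic.dist_right hγ ⟨hv, hv'⟩⟩

theorem image_arc_eq (hT : IsRTree T) {a b a' b' : ℝ} (hab : a < b) (hab' : a' < b')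
    {h k : ℝ → T} (hc : ContinuousOn h (Set.Icc a b)) (kc : ContinuousOn k (Set.Icc a' b'))
    (hi : Set.InjOn h (Set.Icc a b)) (ki : Set.InjOn k (Set.Icc a' b'))
    (h0 : h a = k a') (h1 : h b = k b') : h '' Set.Icc a b = k '' Set.Icc a' b' := by
  have key := hT.uniquelyArcwise ((Set.Icc a b).domRestrict h ∘ (iccHomeoI a b hab).symm)
    ((Set.Icc a' b').domRestrict k ∘ (iccHomeoI a' b' hab').symm)
    (hc.domRestrict.comp (Homeomorph.continuous _)) (kc.domRestrict.comp (Homeomorph.continuous _))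
    (hi.injective.comp (Homeomorph.injective _)) (ki.injective.comp (Homeomorph.injective _))
    (by simpa [Set.domRestrict_apply, iccHomeoI_symm_apply_coe] using h0)
    (by simpa [Set.domRestrict_apply, iccHomeoI_symm_apply_coe] using h1)
  rwa [(Homeomorph.surjective _).range_comp, (Homeomorph.surjective _).range_comp,
    Set.range_domRestrict, Set.range_domRestrict] at key

theorem geodesics_agree_of_le (hT : IsRTree T) {w x y : T} {γ δ : ℝ → T}
    (hγ : IsUnitGeodesic γ w x) (hδ : IsUnitGeodesic δ w y) {t₀ t : ℝ} (ht : 0 ≤ t)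
    (htt : t ≤ t₀) (hx : t₀ ≤ dist w x) (hy : t₀ ≤ dist w y) (h : γ t₀ = δ t₀) : γ t = δ t := by
  rcases ht.eq_or_lt with rfl | ht'
  · rw [hγ.1, hδ.1]
  have sx := Set.Icc_subset_Icc_right (b := (0:ℝ)) hx
  have sy := Set.Icc_subset_Icc_right (b := (0:ℝ)) hy
  have key := hT.image_arc_eq (ht'.trans_le htt) (ht'.trans_le htt) (hγ.continuousOn.mono sx)
    (hδ.continuousOn.mono sy) (hγ.injOn.mono sx) (hδ.injOn.mono sy) (by rw [hγ.1, hδ.1]) h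
  have hm : γ t ∈ γ '' Set.Icc 0 t₀ := ⟨t, ⟨ht, htt⟩, rfl⟩
  rw [key] at hm
  obtain ⟨t', ht1, ht2⟩ := hm
  have e1 := hγ.dist_left (sx ⟨ht, htt⟩)
  rw [← ht2, hδ.dist_left (sy ht1)] at e1
  rw [← ht2, e1]

theorem geodesics_agree (hT : IsRTree T) {w x y : T} {γ δ : ℝ → T}
    (hγ : IsUnitGeodesic γ w x) (hδ : IsUnitGeodesic δ w y) {t : ℝ} (ht : 0 ≤ t)
    (h : 2 * t ≤ dist w x + dist w y - dist x y) :
    γ t = δ t := by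
  have hAc : IsCompact {t ∈ Set.Icc 0 (min (dist w x) (dist w y)) | γ t = δ t} := by
    refine isCompact_Icc.of_isClosed_subset ?_ (fun t ht => ht.1)
    have hγc := hγ.continuousOn.mono (Set.Icc_subset_Icc_right (min_le_left _ (dist w y)))
    have hδc := hδ.continuousOn.mono (Set.Icc_subset_Icc_right (min_le_right (dist w x) _))
    have hc : ContinuousOn (fun t => dist (γ t) (δ t)) (Set.Icc 0 (min (dist w x) (dist w y))) :=
      by fun_prop
    convert hc.preimage_isClosed_of_isClosed isClosed_Icc (isClosed_singleton (x := (0:ℝ))) using 1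
    ext t
    simp [dist_eq_zero]
  obtain ⟨t₀, ⟨⟨h00, h0m⟩, h0⟩, hmax⟩ := hAc.exists_isGreatest
    ⟨0, ⟨⟨le_rfl, le_min dist_nonneg dist_nonneg⟩, by rw [hγ.1, hδ.1]⟩⟩
  have h0x := h0m.trans (min_le_left _ _)
  have h0y := h0m.trans (min_le_right _ _)
  suffices hle : dist w x + dist w y - dist x y ≤ 2 * t₀ from
    hT.geodesics_agree_of_le hγ hδ ht (by linarith) h0x h0y h0
  have m0x : t₀ ∈ Set.Icc 0 (dist w x) := ⟨h00, h0x⟩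
  have m0y : t₀ ∈ Set.Icc 0 (dist w y) := ⟨h00, h0y⟩
  by_cases hne : x = y
  · subst hne
    have : dist w x ≤ t₀ := hmax ⟨⟨dist_nonneg, by simp⟩, by rw [hγ.2.1, hδ.2.1]⟩
    rw [dist_self]
    linarith
  by_cases hab : -(dist w x - t₀) < dist w y - t₀
  swap
  · have := dist_nonneg (x := x) (y := y)
    linarith
  obtain ⟨η, hη⟩ := hT.geodesic x y
  replace hη : IsUnitGeodesic η x y := hη
  let h : ℝ → T := fun u => if u ≤ 0 then γ (t₀ - u) else δ (t₀ + u)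
  have mx : ∀ u ∈ Set.Icc (-(dist w x - t₀)) (dist w y - t₀), u ≤ 0 →
      t₀ - u ∈ Set.Icc 0 (dist w x) := fun u hu hu0 => ⟨by linarith, by linarith [hu.1]⟩
  have my : ∀ u ∈ Set.Icc (-(dist w x - t₀)) (dist w y - t₀), 0 ≤ u →
      t₀ + u ∈ Set.Icc 0 (dist w y) := fun u hu hu0 => ⟨by linarith, by linarith [hu.2]⟩
  have hcross : ∀ u ∈ Set.Icc (-(dist w x - t₀)) (dist w y - t₀),
      ∀ v ∈ Set.Icc (-(dist w x - t₀)) (dist w y - t₀), u ≤ 0 → 0 < v →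
      dist (h u) (h v) ≤ |u - v| ∧ h u ≠ h v := by
    intro u hu v hv hu0 hv0
    simp only [h, if_pos hu0, if_neg hv0.not_ge]
    have du := hγ.2.2 _ (mx u hu hu0) _ m0x
    have dv := hδ.2.2 _ m0y _ (my v hv hv0.le)
    rw [show t₀ - u - t₀ = -u by ring, abs_of_nonneg (by linarith)] at du
    rw [show t₀ - (t₀ + v) = -v by ring, abs_neg, abs_of_pos hv0] at dv
    constructor
    · have := dist_triangle (γ (t₀ - u)) (γ t₀) (δ (t₀ + v))
      rw [h0] at this du
      rw [abs_sub_comm]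
      exact le_trans (by linarith) (le_abs_self _)
    · intro heq
      have e1 := hγ.dist_left (mx u hu hu0)
      rw [heq, hδ.dist_left (my v hv hv0.le)] at e1
      have : t₀ + v ≤ t₀ := hmax ⟨⟨by linarith, le_min (by linarith [hu.1]) (by linarith [hv.2])⟩,
        by rw [← heq, e1]⟩
      linarith
  have hc : ContinuousOn h (Set.Icc (-(dist w x - t₀)) (dist w y - t₀)) := by
    refine (LipschitzOnWith.of_dist_le_mul (K := 1) fun u hu v hv => ?_).continuousOn
    rw [NNReal.coe_one, one_mul, Real.dist_eq]
    rcases le_or_gt u 0 with hu0 | hu0 <;> rcases le_or_gt v 0 with hv0 | hv0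
    · simp only [h, if_pos hu0, if_pos hv0]
      rw [hγ.2.2 _ (mx u hu hu0) _ (mx v hv hv0), abs_sub_comm u v]
      exact (congrArg _ (by ring)).le
    · exact (hcross u hu v hv hu0 hv0).1
    · rw [dist_comm, abs_sub_comm]
      exact (hcross v hv u hu hv0 hu0).1
    · simp only [h, if_neg hu0.not_ge, if_neg hv0.not_ge]
      rw [hδ.2.2 _ (my u hu hu0.le) _ (my v hv hv0.le)]
      exact (congrArg _ (by ring)).le
  have hi : Set.InjOn h (Set.Icc (-(dist w x - t₀)) (dist w y - t₀)) := by
    intro u hu v hv huv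
    rcases le_or_gt u 0 with hu0 | hu0 <;> rcases le_or_gt v 0 with hv0 | hv0
    · simp only [h, if_pos hu0, if_pos hv0] at huv
      linarith [hγ.injOn (mx u hu hu0) (mx v hv hv0) huv]
    · exact absurd huv (hcross u hu v hv hu0 hv0).2
    · exact absurd huv.symm (hcross v hv u hu hv0 hu0).2
    · simp only [h, if_neg hu0.not_ge, if_neg hv0.not_ge] at huv
      linarith [hδ.injOn (my u hu hu0.le) (my v hv hv0.le) huv]
  have ha : h (-(dist w x - t₀)) = η 0 := by
    simp only [h]
    rw [if_pos (by linarith), hη.1, sub_neg_eq_add, add_sub_cancel, hγ.2.1]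
  have hb : h (dist w y - t₀) = η (dist x y) := by
    simp only [h]
    rw [hη.2.1]
    split_ifs with h'
    · have e : t₀ = dist w y := by linarith
      rw [← e, sub_self, sub_zero, h0, e, hδ.2.1]
    · rw [add_sub_cancel, hδ.2.1]
  have key := hT.image_arc_eq hab (dist_pos.2 hne) hc hη.continuousOn hi hη.injOn ha hb
  have hm : h 0 ∈ h '' Set.Icc (-(dist w x - t₀)) (dist w y - t₀) :=
    ⟨0, ⟨by linarith, by linarith⟩, rfl⟩
  rw [key] at hm
  obtain ⟨s, hs, hs'⟩ := hm
  simp only [h, le_refl, if_true, sub_zero] at hs'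
  have e1 := hη.dist_left hs
  have e2 := hη.dist_right hs
  rw [hs', dist_comm, hγ.dist_right m0x] at e1
  rw [hs', h0, hδ.dist_right m0y] at e2
  linarith

theorem fourPoint (hT : IsRTree T) : FourPoint T := by
  intro x z y w
  obtain ⟨γ, hγ⟩ := hT.geodesic w x
  obtain ⟨δ, hδ⟩ := hT.geodesic w y
  obtain ⟨η, hη⟩ := hT.geodesic w z
  replace hγ : IsUnitGeodesic γ w x := hγ
  replace hδ : IsUnitGeodesic δ w y := hδ
  replace hη : IsUnitGeodesic η w z := hη
  have t1 := dist_triangle w x y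
  have t2 := dist_triangle w y x
  have t3 := dist_triangle w y z
  have t4 := dist_triangle w z y
  have t5 := dist_triangle_left x y w
  have t6 := dist_triangle_left y z w
  have c1 := dist_comm y x
  have c2 := dist_comm z y
  have c3 := dist_comm x w
  have c4 := dist_comm y w
  have c5 := dist_comm z w
  set t := min ((dist w x + dist w y - dist x y) / 2) ((dist w y + dist w z - dist y z) / 2) with ht
  have l1 : t ≤ (dist w x + dist w y - dist x y) / 2 := min_le_left _ _
  have l2 : t ≤ (dist w y + dist w z - dist y z) / 2 := min_le_right _ _
  have l0 : 0 ≤ t := le_min (by linarith) (by linarith)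
  have hx : t ∈ Set.Icc 0 (dist w x) := ⟨l0, by linarith⟩
  have hz : t ∈ Set.Icc 0 (dist w z) := ⟨l0, by linarith⟩
  have e1 := hT.geodesics_agree hγ hδ l0 (by linarith)
  have e2 := hT.geodesics_agree hδ hη l0 (by linarith)
  have d1 := hγ.dist_right hx
  have d2 := hη.dist_right hz
  rw [← e2, ← e1] at d2
  have t7 := dist_triangle_left x z (γ t)
  rw [le_max_iff]
  rcases min_choice ((dist w x + dist w y - dist x y) / 2) ((dist w y + dist w z - dist y z) / 2)
    with h | h <;> rw [h] at ht
  · left; linarith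
  · right; linarith

end IsRTree

end MetricTrees

section HeightFunctions

theorem exists_last_hit {c : unitInterval → ℝ} (hc : Continuous c) {a t : unitInterval} {h : ℝ}
    (hat : a ≤ t) (ha : c a ≤ h) (ht : h ≤ c t) :
    ∃ u ∈ Set.Icc a t, c u = h ∧ ∀ w ∈ Set.Icc u t, h ≤ c w := by
  have hK : IsCompact (Set.Icc a t ∩ {u | c u ≤ h}) :=
    isCompact_Icc.inter_right (isClosed_le hc continuous_const)
  obtain ⟨u, ⟨hu, huh⟩, hmax⟩ := hK.exists_isGreatest ⟨a, ⟨le_rfl, hat⟩, ha⟩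
  obtain ⟨u', hu', rfl⟩ := intermediate_value_Icc hu.2 hc.continuousOn ⟨huh, ht⟩
  obtain rfl : u' = u := le_antisymm (hmax ⟨⟨hu.1.trans hu'.1, hu'.2⟩, le_refl (c u')⟩) hu'.1
  refine ⟨u', hu, rfl, fun w hw => ?_⟩
  by_contra! hlt
  obtain rfl : w = u' := le_antisymm (hmax ⟨⟨hu.1.trans hw.1, hw.2⟩, hlt.le⟩) hw.1
  exact lt_irrefl _ hlt

/-- The minimum of `c` over the interval spanned by `s` and `t`. -/
noncomputable def intervalMin (c : C(unitInterval, ℝ)) (s t : unitInterval) : ℝ :=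
  sInf (c '' Set.uIcc s t)

variable (c : C(unitInterval, ℝ))

theorem intervalMin_comm (s t : unitInterval) : intervalMin c s t = intervalMin c t s := by
  rw [intervalMin, intervalMin, Set.uIcc_comm]

theorem intervalMin_le {s t u : unitInterval} (hu : u ∈ Set.uIcc s t) :
    intervalMin c s t ≤ c u :=
  csInf_le (isCompact_uIcc.image c.continuous).bddBelow ⟨u, hu, rfl⟩

theorem exists_eq_intervalMin (s t : unitInterval) :
    ∃ u ∈ Set.uIcc s t, c u = intervalMin c s t :=
  (isCompact_uIcc.image c.continuous).sInf_mem (Set.nonempty_uIcc.image c)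

theorem le_intervalMin {s t : unitInterval} {h : ℝ} (hh : ∀ u ∈ Set.uIcc s t, h ≤ c u) :
    h ≤ intervalMin c s t := by
  obtain ⟨u, hu, hu'⟩ := exists_eq_intervalMin c s t
  exact hu' ▸ hh u hu

theorem intervalMin_self (s : unitInterval) : intervalMin c s s = c s := by
  simp [intervalMin]

theorem intervalMin_le_left (s t : unitInterval) : intervalMin c s t ≤ c s :=
  intervalMin_le c Set.left_mem_uIcc

theorem intervalMin_le_right (s t : unitInterval) : intervalMin c s t ≤ c t :=
  intervalMin_le c Set.right_mem_uIcc

theorem min_intervalMin_le (s t u : unitInterval) :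
    min (intervalMin c s t) (intervalMin c t u) ≤ intervalMin c s u := by
  refine le_intervalMin c fun w hw => ?_
  rcases Set.uIcc_subset_uIcc_union_uIcc (b := t) hw with h | h
  · exact (min_le_left _ _).trans (intervalMin_le c h)
  · exact (min_le_right _ _).trans (intervalMin_le c h)

/-- The tree pseudometric on the unit interval coded by the height function `c`. -/
noncomputable abbrev codedPseudoMetric : PseudoMetricSpace unitInterval where
  dist s t := c s + c t - 2 * intervalMin c s t
  dist_self s := by
    rw [intervalMin_self]
    ring
  dist_comm s t := by
    rw [intervalMin_comm]
    ring
  dist_triangle s t u := by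
    have h1 := intervalMin_le_right c s t
    have h2 := intervalMin_le_left c t u
    rcases min_le_iff.1 (min_intervalMin_le c s t u) with h | h <;> linarith

/-- A copy of the unit interval carrying the tree pseudometric coded by `c`. -/
def CodedInterval (_c : C(unitInterval, ℝ)) : Type := unitInterval

noncomputable instance : PseudoMetricSpace (CodedInterval c) := codedPseudoMetric c

/-- The tree coded by the height function `c`. -/
abbrev CodedTree : Type := SeparationQuotient (CodedInterval c)

/-- The projection from the unit interval onto the tree coded by `c`. -/
noncomputable def codedProj (t : unitInterval) : CodedTree c :=
  SeparationQuotient.mk (X := CodedInterval c) t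

theorem dist_codedProj (s t : unitInterval) :
    dist (codedProj c s) (codedProj c t) = c s + c t - 2 * intervalMin c s t :=
  SeparationQuotient.dist_mk (α := CodedInterval c) s t

theorem codedProj_surjective : Function.Surjective (codedProj c) :=
  SeparationQuotient.surjective_mk (X := CodedInterval c)

theorem continuous_codedProj : Continuous (codedProj c) := by
  refine Metric.continuous_iff'.2 fun t ε hε => ?_
  have hU := Metric.continuous_iff'.1 c.continuous t (ε / 4) (by positivity)
  obtain ⟨δ, hδ, hball⟩ := Metric.eventually_nhds_iff_ball.1 hU
  filter_upwards [Metric.ball_mem_nhds t hδ] with s hs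
  have hk : c t - ε / 4 ≤ intervalMin c s t := by
    refine le_intervalMin c fun u hu => ?_
    have hut : dist u t ≤ dist s t := by
      rw [Subtype.dist_eq, Subtype.dist_eq, Real.dist_eq, Real.dist_eq, abs_sub_comm (u : ℝ),
        abs_sub_comm (s : ℝ)]
      have hu' : (u : ℝ) ∈ Set.uIcc (s : ℝ) t := by
        rcases Set.mem_uIcc.1 hu with h | h
        · exact Set.mem_uIcc.2 (Or.inl h)
        · exact Set.mem_uIcc.2 (Or.inr h)
      exact Set.abs_sub_right_of_mem_uIcc hu'
    have := hball u (hut.trans_lt hs)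
    rw [Real.dist_eq] at this
    linarith [(abs_lt.1 this).1]
  have hs' := hball s hs
  rw [Real.dist_eq] at hs'
  rw [dist_codedProj]
  linarith [(abs_lt.1 hs').2]

theorem continuous_intervalMin_left (t : unitInterval) :
    Continuous fun s => intervalMin c s t := by
  have h : (fun s => intervalMin c s t) =
      fun s => (c s + c t - dist (codedProj c s) (codedProj c t)) / 2 := by
    funext s
    rw [dist_codedProj]
    ring
  rw [h]
  have := continuous_codedProj c
  fun_prop

theorem CodedTree.fourPoint : FourPoint (CodedTree c) := by
  intro x y z w
  obtain ⟨x, rfl⟩ := codedProj_surjective c x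
  obtain ⟨y, rfl⟩ := codedProj_surjective c y
  obtain ⟨z, rfl⟩ := codedProj_surjective c z
  obtain ⟨w, rfl⟩ := codedProj_surjective c w
  simp only [dist_codedProj, le_max_iff]
  have a1 := min_le_iff.1 (min_intervalMin_le c x z y)
  have a2 := min_le_iff.1 (min_intervalMin_le c x w y)
  have a3 := min_le_iff.1 (min_intervalMin_le c z x w)
  have a4 := min_le_iff.1 (min_intervalMin_le c z y w)
  rw [intervalMin_comm c z y, intervalMin_comm c w y] at *
  rw [intervalMin_comm c z x] at a3
  by_contra! hcon
  rcases a1 with a1 | a1 <;> rcases a2 with a2 | a2 <;> rcases a3 with a3 | a3 <;>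
    rcases a4 with a4 | a4 <;> linarith [hcon.1, hcon.2]

theorem exists_below {c : C(unitInterval, ℝ)} (h0 : c 0 = 0) {t : unitInterval} {h : ℝ}
    (hh : 0 ≤ h) (ht : h ≤ c t) : ∃ u, c u = h ∧ intervalMin c u t = h := by
  obtain ⟨u, hu, hu', hw⟩ := exists_last_hit c.continuous t.2.1 (h0.le.trans hh) ht
  refine ⟨u, hu', le_antisymm (hu' ▸ intervalMin_le_left c u t) (le_intervalMin c ?_)⟩
  rwa [Set.uIcc_of_le hu.2]

theorem CodedTree.hasIntermediatePoints {c : C(unitInterval, ℝ)} (h0 : c 0 = 0)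
    (hpos : ∀ t, 0 ≤ c t) : HasIntermediatePoints (CodedTree c) := by
  intro x y v hv hv'
  obtain ⟨x, rfl⟩ := codedProj_surjective c x
  obtain ⟨y, rfl⟩ := codedProj_surjective c y
  have hk0 : 0 ≤ intervalMin c x y := le_intervalMin c fun u _ => hpos u
  rw [dist_codedProj] at hv'
  rcases le_total v (c x - intervalMin c x y) with hle | hle
  · obtain ⟨z, hz, hz'⟩ := exists_below h0 (t := x) (h := c x - v) (by linarith) (by linarith)
    have d1 : dist (codedProj c x) (codedProj c z) = v := by
      rw [dist_codedProj, intervalMin_comm, hz, hz']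
      ring
    refine ⟨codedProj c z, d1, le_antisymm ?_ ?_⟩
    · rw [dist_codedProj, dist_codedProj]
      have h : intervalMin c x y ≤ intervalMin c z y :=
        le_trans (le_min (by linarith) le_rfl) (min_intervalMin_le c z x y)
      linarith
    · have := dist_triangle (codedProj c x) (codedProj c z) (codedProj c y)
      linarith
  · obtain ⟨z, hz, hz'⟩ := exists_below h0 (t := y) (h := 2 * intervalMin c x y - c x + v)
      (by linarith) (by linarith)
    have d1 : dist (codedProj c z) (codedProj c y) =
        dist (codedProj c x) (codedProj c y) - v := by
      rw [dist_codedProj, dist_codedProj, hz, hz']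
      ring
    refine ⟨codedProj c z, le_antisymm ?_ ?_, d1⟩
    · rw [dist_codedProj]
      have h : intervalMin c x y ≤ intervalMin c x z := by
        refine le_trans (le_min le_rfl ?_) (min_intervalMin_le c x y z)
        rw [intervalMin_comm c y z]
        linarith
      linarith
    · have := dist_triangle (codedProj c x) (codedProj c z) (codedProj c y)
      linarith

theorem CodedTree.isRTree {c : C(unitInterval, ℝ)} (h0 : c 0 = 0) (hpos : ∀ t, 0 ≤ c t) :
    IsRTree (CodedTree c) :=
  have : Nonempty (CodedTree c) := ⟨codedProj c 0⟩
  (CodedTree.fourPoint c).isRTree (CodedTree.hasIntermediatePoints h0 hpos)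

end HeightFunctions

section Codes

variable {X : Type*}

/-- The height function `c`, with `l` the height along the reduced path, exhibits `β` as the
reduction of `α` through the tree coded by `c`. -/
structure Codes (c l : C(unitInterval, ℝ)) (α β : unitInterval → X) : Prop where
  nonneg : ∀ t, 0 ≤ c t
  map_zero : c 0 = 0
  strictMono : StrictMono l
  left_zero : l 0 = 0
  right_one : l 1 = c 1
  eq_of_le : ∀ s t, s ≤ t → c s = c t → (∀ u ∈ Set.Icc s t, c s ≤ c u) → α s = α t
  eq_reduced : ∀ u v, c u = l v → (∀ w, u ≤ w → c u ≤ c w) → α u = β v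

theorem GeodesicReduction.exists_codes [TopologicalSpace X] {α β : unitInterval → X}
    (h : GeodesicReduction α β) : ∃ c l, Codes c l α β := by
  obtain ⟨T, _, hT, f, p, r, -, hp, hr, hri, h0, h1, rfl, rfl⟩ := h
  have h4 := hT.fourPoint
  have hI := hT.hasIntermediatePoints
  let l : C(unitInterval, ℝ) := ⟨fun t => dist (r 0) (r t), by fun_prop⟩
  have hlinj : Function.Injective l := by
    intro s t hst
    refine hri (dist_eq_zero.1 ?_)
    rw [h4.dist_of_mem_segment (h4.arc_mem_segment hI hr hri s) (h4.arc_mem_segment hI hr hri t)]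
    exact abs_eq_zero.2 (sub_eq_zero.2 hst)
  have hmono : StrictMono l := by
    refine (l.continuous.strictMono_of_inj hlinj).resolve_right fun hanti => ?_
    have h01 : l 1 < l 0 := hanti zero_lt_one
    simp only [l, ContinuousMap.coe_mk, dist_self] at h01
    exact absurd h01 dist_nonneg.not_gt
  refine ⟨⟨fun t => dist (r 0) (p t), by fun_prop⟩, l, fun t => dist_nonneg, ?_, hmono, ?_, ?_,
    ?_, ?_⟩
  · simp [h0]
  · simp [l]
  · simp [l, h1]
  · intro s t hst hc hle
    refine congrArg f (h4.eq_of_forall_le_dist hI (isPreconnected_Icc.image p hp.continuousOn)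
      ⟨s, ⟨le_rfl, hst⟩, rfl⟩ ⟨t, ⟨hst, le_rfl⟩, rfl⟩ hc ?_)
    rintro _ ⟨u, hu, rfl⟩
    exact hle u hu
  · intro u v hc hle
    have hK : IsPreconnected (p '' Set.Icc u 1 ∪ r '' Set.Icc v 1) :=
      IsPreconnected.union (r 1) ⟨1, ⟨u.2.2, le_rfl⟩, h1.symm⟩ ⟨1, ⟨v.2.2, le_rfl⟩, rfl⟩
        (isPreconnected_Icc.image p hp.continuousOn) (isPreconnected_Icc.image r hr.continuousOn)
    refine congrArg f (h4.eq_of_forall_le_dist hI hK (Or.inl ⟨u, ⟨le_rfl, u.2.2⟩, rfl⟩)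
      (Or.inr ⟨v, ⟨le_rfl, v.2.2⟩, rfl⟩) hc ?_)
    rintro _ (⟨w, hw, rfl⟩ | ⟨w, hw, rfl⟩)
    · exact hle w hw.1
    · exact hc.le.trans (hmono.monotone hw.1)

theorem Codes.geodesicReduction [TopologicalSpace X] {α β : unitInterval → X}
    {c l : C(unitInterval, ℝ)} (h : Codes c l α β) (hα : Continuous α) :
    GeodesicReduction α β := by
  have hex : ∀ v, ∃ u, c u = l v ∧ ∀ w, u ≤ w → l v ≤ c w := by
    intro v
    obtain ⟨u, -, hu, hw⟩ := exists_last_hit c.continuous (a := 0) (t := 1) (h := l v) zero_le_one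
      (by rw [h.map_zero, ← h.left_zero]; exact h.strictMono.monotone v.2.1)
      (by rw [← h.right_one]; exact h.strictMono.monotone v.2.2)
    exact ⟨u, hu, fun w huw => hw w ⟨huw, w.2.2⟩⟩
  choose u hu hw using hex
  have hle : ∀ v v', dist (codedProj c (u v)) (codedProj c (u v')) ≤ dist (l v) (l v') := by
    intro v v'
    have hk : min (l v) (l v') ≤ intervalMin c (u v) (u v') := by
      refine le_intervalMin c fun w hw' => ?_
      rcases Set.mem_uIcc.1 hw' with h' | h'
      · exact (min_le_left _ _).trans (hw v w h'.1)
      · exact (min_le_right _ _).trans (hw v' w h'.1)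
    rw [dist_codedProj, hu, hu, Real.dist_eq]
    rcases min_choice (l v) (l v') with h' | h' <;> rw [h'] at hk
    · exact le_trans (by linarith) (neg_le_abs _)
    · exact le_trans (by linarith) (le_abs_self _)
  have hge : ∀ s t, dist (c s) (c t) ≤ dist (codedProj c s) (codedProj c t) := by
    intro s t
    have h1 := intervalMin_le_left c s t
    have h2 := intervalMin_le_right c s t
    rw [dist_codedProj, Real.dist_eq, abs_le]
    constructor <;> linarith
  have hrc : Continuous fun v => codedProj c (u v) := by
    refine continuous_iff_continuousAt.2 fun v => tendsto_iff_dist_tendsto_zero.2 ?_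
    exact squeeze_zero (fun _ => dist_nonneg) (fun v' => hle v' v)
      (tendsto_iff_dist_tendsto_zero.1 l.continuous.continuousAt)
  let π : C(unitInterval, CodedTree c) := ⟨codedProj c, continuous_codedProj c⟩
  have hquot : IsQuotientMap π :=
    π.continuous.isClosedMap.isQuotientMap π.continuous (codedProj_surjective c)
  have hcompat : ∀ s t, s ≤ t → codedProj c s = codedProj c t → α s = α t := by
    intro s t hst heq
    have hd := dist_codedProj c s t
    rw [heq, dist_self] at hd
    have h1 := intervalMin_le_left c s t
    have h2 := intervalMin_le_right c s t
    refine h.eq_of_le s t hst (by linarith) fun w hw => ?_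
    have := intervalMin_le c (Set.Icc_subset_uIcc hw)
    linarith
  have hfac : Function.FactorsThrough (⟨α, hα⟩ : C(unitInterval, X)) π := fun s t heq => by
    rcases le_total s t with hst | hst
    · exact hcompat s t hst heq
    · exact (hcompat t s hst heq.symm).symm
  let f : C(CodedTree c, X) := hquot.lift ⟨α, hα⟩ hfac
  have hf : ∀ t, f (codedProj c t) = α t := fun t =>
    congrArg (fun g : C(unitInterval, X) => g t) (hquot.lift_comp ⟨α, hα⟩ hfac)
  refine ⟨CodedTree c, inferInstance, CodedTree.isRTree h.map_zero h.nonneg, f, codedProj c,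
    fun v => codedProj c (u v), f.continuous, continuous_codedProj c, hrc, ?_, ?_, ?_,
    funext hf, ?_⟩
  · intro v v' heq
    have := hge (u v) (u v')
    rw [show codedProj c (u v) = codedProj c (u v') from heq, dist_self, hu, hu] at this
    exact h.strictMono.injective (dist_le_zero.1 this)
  · refine dist_le_zero.1 ?_
    have hk : 0 ≤ intervalMin c (u 0) 0 := le_intervalMin c fun w _ => h.nonneg w
    rw [dist_codedProj, hu, h.map_zero, h.left_zero]
    linarith
  · refine dist_le_zero.1 ?_
    have hk : l 1 ≤ intervalMin c (u 1) 1 := by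
      refine le_intervalMin c fun w hw' => hw 1 w ?_
      rw [Set.uIcc_of_le (unitInterval.le_one' (t := u 1))] at hw'
      exact hw'.1
    rw [dist_codedProj, hu, ← h.right_one]
    linarith
  · funext v
    exact (hf (u v)).trans (h.eq_reduced _ _ (hu v) fun w hw' => (hu v).trans_le (hw v w hw'))

theorem Codes.trans {α β γ : unitInterval → X} {c l c' l' : C(unitInterval, ℝ)}
    (h : Codes c l α β) (h' : Codes c' l' β γ) : ∃ c'', Codes c'' l' α γ := by
  let m : unitInterval → ℝ := fun t => intervalMin c t 1
  have hmc : Continuous m := continuous_intervalMin_left c 1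
  have hle_c : ∀ {t w}, t ≤ w → m t ≤ c w := fun {t w} htw =>
    intervalMin_le c (by rw [Set.uIcc_of_le (unitInterval.le_one' (t := t))]; exact ⟨htw, w.2.2⟩)
  have hle_m : ∀ {t a}, (∀ w, t ≤ w → a ≤ c w) → a ≤ m t := fun {t a} hw =>
    le_intervalMin c fun w hw' => hw w <| by
      rw [Set.uIcc_of_le (unitInterval.le_one' (t := t))] at hw'
      exact hw'.1
  have hmono : Monotone m := fun s t hst => hle_m fun w hw => hle_c (hst.trans hw)
  have hm1 : m 1 = c 1 := intervalMin_self c 1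
  have hm0 : ∀ t, 0 ≤ m t := fun t => hle_m fun w _ => h.nonneg w
  have hex : ∀ t, ∃ v, l v = m t := by
    intro t
    have : m t ∈ Set.Icc (l 0) (l 1) := by
      rw [h.left_zero, h.right_one, ← hm1]
      exact ⟨hm0 t, hmono t.2.2⟩
    obtain ⟨v, -, hv⟩ := intermediate_value_Icc (zero_le_one' unitInterval)
      l.continuous.continuousOn this
    exact ⟨v, hv⟩
  choose φ hφ using hex
  have hφc : Continuous φ := by
    rw [(l.continuous.isClosedEmbedding h.strictMono.injective).continuous_iff]
    exact hmc.congr fun t => (hφ t).symm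
  have hφ0 : φ 0 = 0 := h.strictMono.injective <| by
    rw [hφ, h.left_zero]
    exact le_antisymm (h.map_zero ▸ hle_c le_rfl) (hm0 0)
  have hφ1 : φ 1 = 1 := h.strictMono.injective <| by rw [hφ, h.right_one, hm1]
  let c'' : C(unitInterval, ℝ) := ⟨fun t => c' (φ t) + (c t - m t), by fun_prop⟩
  have hc'' : ∀ t, c'' t = c' (φ t) + (c t - m t) := fun t => rfl
  -- every level between `m s` and `m t` is attained as a running minimum between `s` and `t`
  have hit : ∀ {s t v}, s ≤ t → m s ≤ l v → l v ≤ m t → (m s < m t ∨ c t = m t) →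
      ∃ u ∈ Set.Icc s t, φ u = v ∧ c'' u = c' v := by
    intro s t v hst hsv hvt hcase
    obtain ⟨u, hu, hcu, hmu⟩ : ∃ u ∈ Set.Icc s t, c u = l v ∧ m u = l v := by
      obtain ⟨a, ha, hca⟩ := exists_eq_intervalMin c s 1
      rw [Set.uIcc_of_le (unitInterval.le_one' (t := s))] at ha
      change c a = m s at hca
      rcases le_or_gt a t with hat | hat
      · obtain ⟨u, hu, hcu, hw⟩ := exists_last_hit c.continuous hat (hca.le.trans hsv)
          (hvt.trans (hle_c le_rfl))
        refine ⟨u, ⟨ha.1.trans hu.1, hu.2⟩, hcu, le_antisymm (hcu ▸ hle_c le_rfl) ?_⟩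
        refine hle_m fun w huw => ?_
        rcases le_total w t with hwt | hwt
        · exact hw w ⟨huw, hwt⟩
        · exact hvt.trans (hle_c hwt)
      · have hts : m t ≤ m s := hca ▸ hle_c hat.le
        have htv : m t = l v := le_antisymm (hts.trans hsv) hvt
        exact ⟨t, ⟨hst, le_rfl⟩, (hcase.resolve_left hts.not_gt).trans htv, htv⟩
    obtain rfl : φ u = v := h.strictMono.injective ((hφ u).trans hmu)
    exact ⟨u, hu, rfl, by rw [hc'', hcu, hmu, sub_self, add_zero]⟩
  have hred : ∀ {t}, c t = m t → α t = β (φ t) := fun {t} ht =>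
    h.eq_reduced t (φ t) (ht.trans (hφ t).symm) fun w hw => ht.trans_le (hle_c hw)
  have hcm : ∀ t, m t ≤ c t := fun t => hle_c le_rfl
  refine ⟨c'', fun t => ?_, ?_, h'.strictMono, h'.left_zero, ?_, ?_, ?_⟩
  · rw [hc'']
    linarith [h'.nonneg (φ t), hcm t]
  · rw [hc'', hφ0, h'.map_zero, h.map_zero, ← hφ 0, hφ0, h.left_zero]
    ring
  · rw [hc'', hφ1, hm1, h'.right_one]
    ring
  · intro s t hst heq hle
    rcases (hmono hst).eq_or_lt with hms | hms
    · have hφe : ∀ u ∈ Set.Icc s t, m u = m s ∧ φ u = φ s := by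
        intro u hu
        have : m u = m s := le_antisymm (hms ▸ hmono hu.2) (hmono hu.1)
        exact ⟨this, h.strictMono.injective (by rw [hφ, hφ, this])⟩
      have ht := hφe t ⟨hst, le_rfl⟩
      rw [hc'', hc'', ht.1, ht.2] at heq
      refine h.eq_of_le s t hst (by linarith) fun u hu => ?_
      have := hle u hu
      rw [hc'', hc'', (hφe u hu).1, (hφe u hu).2] at this
      linarith
    · have hge : ∀ v, m s ≤ l v → l v ≤ m t → c'' s ≤ c' v := by
        intro v hsv hvt
        obtain ⟨u, hu, -, hcu⟩ := hit hst hsv hvt (Or.inl hms)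
        exact hcu ▸ hle u hu
      have hs := hge (φ s) (hφ s).ge ((hφ s).trans_le hms.le)
      have ht := hge (φ t) (hms.le.trans (hφ t).ge) (hφ t).le
      have es : c s = m s := le_antisymm (by linarith [hc'' s]) (hcm s)
      have et : c t = m t := le_antisymm (by linarith [hc'' t]) (hcm t)
      have e's : c'' s = c' (φ s) := by rw [hc'', es, sub_self, add_zero]
      have e't : c'' t = c' (φ t) := by rw [hc'', et, sub_self, add_zero]
      rw [hred es, hred et]
      refine h'.eq_of_le _ _ (h.strictMono.le_iff_le.1 (by rw [hφ, hφ]; exact hms.le))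
        (by rw [← e's, ← e't, heq]) fun v hv => ?_
      rw [← e's]
      exact hge v ((hφ s).ge.trans (h.strictMono.monotone hv.1))
        ((h.strictMono.monotone hv.2).trans (hφ t).le)
  · intro u v heq hle
    have hge : ∀ w, φ u ≤ w → c'' u ≤ c' w := by
      intro w hw
      obtain ⟨x, hx, -, hcx⟩ := hit (s := u) (t := 1) (v := w) u.2.2
        ((hφ u).ge.trans (h.strictMono.monotone hw))
        ((h.strictMono.monotone w.2.2).trans (by rw [h.right_one, hm1])) (Or.inr hm1.symm)
      exact hcx ▸ hle x hx.1
    have eu : c u = m u := le_antisymm (by linarith [hc'' u, hge _ le_rfl]) (hcm u)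
    have e'u : c'' u = c' (φ u) := by rw [hc'', eu, sub_self, add_zero]
    rw [hred eu]
    exact h'.eq_reduced _ _ (e'u ▸ heq) fun w hw => e'u ▸ hge w hw

end Codes

/-- The relation `≥ᵣ` of geodesic ℝ-tree reduction is transitive. -/
theorem geodesicReduction_trans {X : Type*} [TopologicalSpace X] [T2Space X]
    (α β γ : unitInterval → X) (hα : Continuous α) (hβ : Continuous β) (hγ : Continuous γ)
    (h₁ : GeodesicReduction α β) (h₂ : GeodesicReduction β γ) :
    GeodesicReduction α γ := by
  obtain ⟨c, l, h⟩ := h₁.exists_codes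
  obtain ⟨c', l', h'⟩ := h₂.exists_codes
  obtain ⟨c'', h''⟩ := h.trans h'
  exact h''.geodesicReduction hα
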